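/- For every integer n ≥ 0, the cyclic group ℤ/2^nℤ has property L. -/

import Mathlib

/-- The natural reduction ring homomorphism `W₂(k) → k` from length-two `p`-typical
Witt vectors to `k`, given by the zeroth coefficient. -/
noncomputable def wittReduce (p : ℕ) [Fact p.Prime] (k : Type*) [CommRing k] :
    TruncatedWittVector p 2 k →+* k :=
  RingHom.liftOfRightInverse (WittVector.truncate 2) TruncatedWittVector.out
    TruncatedWittVector.truncateFun_out
    ⟨WittVector.constantCoeff, fun x hx => by
      rw [WittVector.mem_ker_truncate] at hx
      simpa [RingHom.mem_ker] using hx 0 (by norm_num)⟩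

/-- A finite group `G` has property `L_p` if every homomorphism `G → GL_n(k)`, for `k` a
finite field of characteristic `p`, lifts to `GL_n(W₂(k))`. -/
def HasLp (p : ℕ) [Fact p.Prime] (G : Type*) [Group G] : Prop :=
  ∀ (n : ℕ), 1 ≤ n → ∀ (k : Type) [Field k] [Fintype k] [CharP k p],
    ∀ f : G →* GL (Fin n) k,
      ∃ g : G →* GL (Fin n) (TruncatedWittVector p 2 k),
        (Matrix.GeneralLinearGroup.map (wittReduce p k)).comp g = f

/-- A group has property `L` if it has property `L_p` for every prime `p`. -/
def HasL (G : Type*) [Group G] : Prop :=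
  ∀ (p : ℕ) [Fact p.Prime], HasLp p G

open Polynomial Module

section Reduction

variable {W k : Type*} [CommRing W] [CommRing k] (r : W →+* k)

theorem isUnit_of_isUnit_map_of_ker_mul_eq_zero (hr : Function.Surjective r)
    (h0 : ∀ x y, r x = 0 → r y = 0 → x * y = 0) {x : W} (hx : IsUnit (r x)) : IsUnit x := by
  obtain ⟨y, hy⟩ := hx.exists_right_inv
  obtain ⟨y, rfl⟩ := hr y
  have h : (x * y - 1) * (x * y - 1) = 0 := h0 _ _ (by simp [hy]) (by simp [hy])
  exact IsUnit.of_mul_eq_one (y * (2 - x * y)) (by linear_combination -h)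

theorem Matrix.GeneralLinearGroup.map_surjective_of_ker_mul_eq_zero {m : Type*} [Fintype m]
    [DecidableEq m] (hr : Function.Surjective r)
    (h0 : ∀ x y, r x = 0 → r y = 0 → x * y = 0) :
    Function.Surjective (Matrix.GeneralLinearGroup.map (n := m) r) := by
  intro A
  choose s hs using hr
  have hA : r.mapMatrix ((A : Matrix m m k).map s) = A := by
    ext i j
    simp [hs]
  have hdet : IsUnit ((A : Matrix m m k).map s).det := by
    apply isUnit_of_isUnit_map_of_ker_mul_eq_zero r (fun x => ⟨s x, hs x⟩) h0
    rw [RingHom.map_det, hA]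
    exact (Matrix.isUnit_iff_isUnit_det _).mp A.isUnit
  exact ⟨Matrix.GeneralLinearGroup.mk'' _ hdet, Units.ext hA⟩

theorem Matrix.pow_eq_one_of_mapMatrix_eq_one {m : Type*} [Fintype m] [DecidableEq m] {p : ℕ}
    [CharP k p] (h0 : ∀ x y, r x = 0 → r y = 0 → x * y = 0) {B : Matrix m m W}
    (hB : r.mapMatrix B = 1) : B ^ p = 1 := by
  obtain ⟨Y, rfl⟩ : ∃ Y, B = 1 + Y := ⟨B - 1, by abel⟩
  have hY : ∀ i j, r (Y i j) = 0 := by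
    intro i j
    have h : r.mapMatrix Y = 0 := by rwa [map_add, map_one, add_eq_left] at hB
    exact congr_fun₂ h i j
  have hYY : Y * Y = 0 := by
    ext i j
    simp [Matrix.mul_apply, h0 _ _ (hY _ _) (hY _ _)]
  have hpow : ∀ a : ℕ, (1 + Y) ^ a = 1 + a • Y := by
    intro a
    induction a with
    | zero => simp
    | succ a ih =>
      rw [pow_succ, ih, mul_add, mul_one, add_mul, one_mul, smul_mul_assoc, hYY, succ_nsmul]
      simp [add_assoc]
  rw [hpow, add_eq_left]
  ext i j
  rw [Matrix.smul_apply, nsmul_eq_mul]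
  exact h0 _ _ (by simp) (hY i j)

theorem Polynomial.exists_monic_dvd_X_pow_sub_one_map_eq [CharP k 2] (n : ℕ) :
    ∀ j ≤ 2 ^ n, ∃ g : W[X], g.Monic ∧ g ∣ X ^ 2 ^ n - 1 ∧ g.map r = (X - 1) ^ j := by
  induction n with
  | zero =>
    intro j hj
    have : j = 0 ∨ j = 1 := by
      have : j ≤ 1 := by simpa using hj
      omega
    obtain rfl | rfl := this
    · exact ⟨1, monic_one, one_dvd _, by simp⟩
    · exact ⟨X - 1, by simpa using monic_X_sub_C (1 : W), by simp, by simp⟩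
  | succ n ih =>
    intro j hj
    have hfac : (X ^ 2 ^ (n + 1) - 1 : W[X]) = (X ^ 2 ^ n - 1) * (X ^ 2 ^ n + 1) := by ring
    rcases le_or_gt j (2 ^ n) with h | h
    · obtain ⟨g, hg, hd, hm⟩ := ih j h
      exact ⟨g, hg, hfac ▸ hd.mul_right _, hm⟩
    · obtain ⟨g, hg, hd, hm⟩ := ih (j - 2 ^ n) (by rw [pow_succ] at hj; omega)
      refine ⟨g * (X ^ 2 ^ n + 1), hg.mul ?_, hfac ▸ mul_dvd_mul_right hd _, ?_⟩
      · simpa using monic_X_pow_add_C (1 : W) (pow_ne_zero n two_ne_zero)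
      · have hk : (X ^ 2 ^ n + 1 : k[X]) = (X - 1) ^ 2 ^ n := by
          rw [sub_pow_char_pow, one_pow, CharTwo.sub_eq_add]
        rw [Polynomial.map_mul, hm, Polynomial.map_add, Polynomial.map_pow, map_X,
          Polynomial.map_one, hk, ← pow_add, Nat.sub_add_cancel h.le]

end Reduction

section LiftableEnd

variable {W k : Type*} [CommRing W] [Field k] (r : W →+* k) (N : ℕ)

/-- In some basis, the matrix of `φ` is the reduction along `r` of a matrix of order
dividing `N`. -/
def Module.End.IsLiftable {V : Type*} [AddCommGroup V] [Module k V] (φ : Module.End k V) : Prop :=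
  ∃ (ι : Type) (_ : Fintype ι) (_ : DecidableEq ι) (b : Basis ι k V) (B : Matrix ι ι W),
    B ^ N = 1 ∧ ∀ i, φ (b i) = ∑ j, r (B j i) • b j

variable {r N}

namespace Module.End.IsLiftable

theorem of_equiv {V V' : Type*} [AddCommGroup V] [Module k V] [AddCommGroup V'] [Module k V']
    {φ : Module.End k V} {ψ : Module.End k V'} (h : φ.IsLiftable r N) (e : V ≃ₗ[k] V')
    (he : ∀ x, e (φ x) = ψ (e x)) : ψ.IsLiftable r N := by
  obtain ⟨ι, _, _, b, B, hB, hb⟩ := h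
  refine ⟨ι, _, _, b.map e, B, hB, fun i => ?_⟩
  simp [← he, hb]

theorem pi {κ : Type} [Fintype κ] {V : κ → Type*} [∀ i, AddCommGroup (V i)]
    [∀ i, Module k (V i)] {φ : ∀ i, Module.End k (V i)} (h : ∀ i, (φ i).IsLiftable r N)
    {ψ : Module.End k (∀ i, V i)} (hψ : ∀ x i, ψ x i = φ i (x i)) : ψ.IsLiftable r N := by
  classical
  choose ι _ _ b B hB hb using h
  refine ⟨Σ i, ι i, inferInstance, inferInstance, Pi.basis b, Matrix.blockDiagonal' B, ?_, ?_⟩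
  · rw [← Matrix.blockDiagonal'_pow, ← Matrix.blockDiagonal'_one]
    exact congr_arg _ (funext hB)
  · rintro ⟨i, a⟩
    ext l
    rw [hψ, Finset.sum_apply, Fintype.sum_sigma]
    simp only [Pi.smul_apply, Pi.basis_apply]
    rw [Finset.sum_eq_single l]
    · rcases eq_or_ne l i with rfl | hl
      · simp [hb]
      · simp [Matrix.blockDiagonal'_apply_ne, hl]
    · intro l' _ hl
      simp [hl.symm]
    · simp

theorem adjoinRoot {g : W[X]} {q : k[X]} (hg : g.Monic) (hq : q = g.map r)
    (hN : g ∣ X ^ N - 1) :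
    (Algebra.lmul k (AdjoinRoot q) (AdjoinRoot.root q)).IsLiftable r N := by
  subst hq
  have hq : (g.map r).Monic := hg.map r
  have hd : (g.map r).natDegree = g.natDegree := hg.natDegree_map r
  let b : Basis (Fin g.natDegree) W (AdjoinRoot g) := (AdjoinRoot.powerBasis' hg).basis
  let c : Basis (Fin g.natDegree) k (AdjoinRoot (g.map r)) :=
    (AdjoinRoot.powerBasis' hq).basis.reindex (finCongr hd)
  let F := AdjoinRoot.map r g (g.map r) dvd_rfl
  have hb : ∀ i, b i = AdjoinRoot.root g ^ (i : ℕ) := fun i =>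
    (AdjoinRoot.powerBasis' hg).basis_eq_pow i
  have hc : ∀ i, c i = AdjoinRoot.root (g.map r) ^ (i : ℕ) := fun i => by
    rw [Basis.reindex_apply]
    exact (AdjoinRoot.powerBasis' hq).basis_eq_pow _
  have hF : ∀ i, F (b i) = c i := fun i => by
    rw [hb, hc, map_pow, AdjoinRoot.map_root]
  refine ⟨Fin g.natDegree, inferInstance, inferInstance, c,
    Algebra.leftMulMatrix b (AdjoinRoot.root g), ?_, fun i => ?_⟩
  · rw [← map_pow]
    have : AdjoinRoot.root g ^ N = 1 := by
      rw [← sub_eq_zero, AdjoinRoot.root, ← map_pow, ← map_one (AdjoinRoot.mk g), ← map_sub]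
      exact AdjoinRoot.mk_eq_zero.mpr hN
    rw [this, map_one]
  · have h := congr_arg F (b.sum_repr (AdjoinRoot.root g * b i))
    rw [map_mul F, hF, AdjoinRoot.map_root, map_sum] at h
    rw [Algebra.coe_lmul_eq_mul, LinearMap.mul_apply', ← h]
    refine Finset.sum_congr rfl fun j _ => ?_
    rw [Algebra.leftMulMatrix_eq_repr_mul, Algebra.smul_def, map_mul, hF,
      AdjoinRoot.algebraMap_eq, AdjoinRoot.map_of, Algebra.smul_def, AdjoinRoot.algebraMap_eq]

theorem of_pow_two_pow_eq_one [CharP k 2] {V : Type} [AddCommGroup V] [Module k V]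
    [FiniteDimensional k V] (n : ℕ) {φ : Module.End k V} (hφ : φ ^ 2 ^ n = 1) :
    φ.IsLiftable r (2 ^ n) := by
  classical
  have hirr : Irreducible (X - 1 : k[X]) := by simpa using irreducible_X_sub_C (1 : k)
  have hkill : ∀ x : AEval' φ, (X - 1 : k[X]) ^ 2 ^ n • x = 0 := by
    intro x
    obtain ⟨x, rfl⟩ := (AEval'.of φ).surjective x
    rw [sub_pow_char_pow, one_pow, sub_smul, AEval'.X_pow_smul_of, hφ]
    simp
  obtain ⟨d, e, ⟨E⟩⟩ := Module.torsion_by_prime_power_decomposition (M := AEval' φ) hirr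
    ((Submodule.isTorsion'_powers_iff _).mpr fun x => ⟨2 ^ n, hkill x⟩)
  have he : ∀ i, e i ≤ 2 ^ n := by
    intro i
    let y := DirectSum.lof k[X] (Fin d) (fun i => k[X] ⧸ k[X] ∙ (X - 1 : k[X]) ^ e i) i
      (Submodule.Quotient.mk 1)
    have hy : (X - 1 : k[X]) ^ 2 ^ n • y = 0 := by
      rw [← E.apply_symm_apply y, ← map_smul, hkill, map_zero]
    have hy' : (X - 1 : k[X]) ^ 2 ^ n • y i = 0 := DFinsupp.ext_iff.mp hy i
    rw [DirectSum.lof_apply, ← Submodule.Quotient.mk_smul, Submodule.Quotient.mk_eq_zero,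
      Submodule.mem_span_singleton, smul_eq_mul, mul_one] at hy'
    obtain ⟨a, ha⟩ := hy'
    exact (pow_dvd_pow_iff hirr.ne_zero hirr.not_isUnit).mp
      ⟨a, by rw [← ha, smul_eq_mul, mul_comm]⟩
  have hQ : ∀ i, (Algebra.lsmul k k (k[X] ⧸ k[X] ∙ (X - 1 : k[X]) ^ e i) (X : k[X])).IsLiftable r
      (2 ^ n) := by
    intro i
    obtain ⟨g, hg, hd, hm⟩ := exists_monic_dvd_X_pow_sub_one_map_eq r n (e i) (he i)
    exact (adjoinRoot hg hm.symm hd).of_equiv (LinearEquiv.refl k _) fun x => rfl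
  have hpi := pi hQ (ψ := Algebra.lsmul k k (∀ i, k[X] ⧸ k[X] ∙ (X - 1 : k[X]) ^ e i) (X : k[X]))
    fun x i => rfl
  let E' : AEval' φ ≃ₗ[k[X]] ∀ i, k[X] ⧸ k[X] ∙ (X - 1 : k[X]) ^ e i :=
    E.trans (DirectSum.linearEquivFunOnFintype _ _ _)
  refine hpi.of_equiv ((E'.symm.restrictScalars k).trans (AEval'.of φ).symm) fun x => ?_
  have h : E'.symm ((X : k[X]) • x) = (X : k[X]) • E'.symm x := map_smul _ _ _
  exact (congr_arg (AEval'.of φ).symm h).trans (AEval'.of_symm_X_smul φ _)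

end Module.End.IsLiftable

end LiftableEnd

section Main

theorem zmod_hom_ext {N : ℕ} {H : Type*} [Group H] {f g : Multiplicative (ZMod N) →* H}
    (h : f (.ofAdd 1) = g (.ofAdd 1)) : f = g := by
  refine MonoidHom.ext fun x => ?_
  have hx : x = .ofAdd 1 ^ (x.toAdd.cast : ℤ) := by
    rw [← ofAdd_zsmul, zsmul_one, ZMod.intCast_cast, ZMod.cast_id', id, ofAdd_toAdd]
  rw [hx, map_zpow, map_zpow, h]

theorem exists_zmod_hom {N : ℕ} {H : Type*} [Group H] {u : H} (hu : u ^ N = 1) :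
    ∃ g : Multiplicative (ZMod N) →* H, g (.ofAdd 1) = u := by
  let φ : ℤ →+ Additive H := zmultiplesHom _ (.ofMul u)
  have hφ : φ N = 0 := by
    rw [zmultiplesHom_apply, natCast_zsmul, ← ofMul_pow, hu, ofMul_one]
  refine ⟨AddMonoidHom.toMultiplicativeLeft (ZMod.lift N ⟨φ, hφ⟩), ?_⟩
  have h : ZMod.lift N ⟨φ, hφ⟩ ((1 : ℤ) : ZMod N) = φ 1 := ZMod.lift_coe _ _ _
  rw [Int.cast_one, zmultiplesHom_apply, one_zsmul] at h
  exact congr_arg Additive.toMul h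

theorem wittReduce_truncate (p : ℕ) [Fact p.Prime] (k : Type*) [CommRing k]
    (x : WittVector p k) : wittReduce p k (WittVector.truncate 2 x) = x.coeff 0 := by
  exact RingHom.liftOfRightInverse_comp_apply _ _ _ _ _

theorem wittReduce_surjective (p : ℕ) [Fact p.Prime] (k : Type*) [CommRing k] :
    Function.Surjective (wittReduce p k) := fun x =>
  ⟨WittVector.truncate 2 (WittVector.teichmuller p x), by
    rw [wittReduce_truncate, WittVector.teichmuller_coeff_zero]⟩

theorem mul_eq_zero_of_wittReduce_eq_zero (p : ℕ) [Fact p.Prime] (k : Type*) [CommRing k]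
    [CharP k p] (x y : TruncatedWittVector p 2 k) (hx : wittReduce p k x = 0)
    (hy : wittReduce p k y = 0) : x * y = 0 := by
  obtain ⟨x, rfl⟩ := WittVector.truncate_surjective p 2 k x
  obtain ⟨y, rfl⟩ := WittVector.truncate_surjective p 2 k y
  rw [wittReduce_truncate] at hx hy
  have aux : ∀ z : WittVector p k, z.coeff 0 = 0 → ∃ t, z = WittVector.verschiebung t := fun z hz =>
    ⟨_, WittVector.eq_iterate_verschiebung (n := 1) (by simpa using hz)⟩
  obtain ⟨x, rfl⟩ := aux x hx
  obtain ⟨y, rfl⟩ := aux y hy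
  rw [← map_mul, ← RingHom.mem_ker, WittVector.mem_ker_truncate,
    ← WittVector.verschiebung_mul_frobenius, WittVector.frobenius_verschiebung, ← mul_assoc]
  intro i hi
  interval_cases i
  · exact WittVector.verschiebung_coeff_zero _
  · rw [WittVector.verschiebung_coeff_add_one, WittVector.mul_charP_coeff_zero]

/-- If the kernel of a surjection has exponent `p` coprime to `N`, then elements of order
dividing `N` lift to elements of order dividing `N`. -/
theorem exists_lift_pow_eq_one_of_coprime {G H : Type*} [Group G] [Group H] {π : G →* H}
    (hπ : Function.Surjective π) {p N : ℕ} (hp : ∀ x, π x = 1 → x ^ p = 1) (hpN : p.Coprime N)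
    {a : H} (ha : a ^ N = 1) : ∃ b, π b = a ∧ b ^ N = 1 := by
  obtain ⟨b, rfl⟩ := hπ a
  have hb : (b ^ N) ^ p = 1 := hp _ (by rw [map_pow, ha])
  have hbez : (p : ℤ) * p.gcdA N = 1 - N * p.gcdB N := by
    have h := Nat.gcd_eq_gcd_ab p N
    rw [hpN, Nat.cast_one] at h
    linarith
  refine ⟨b ^ (p * p.gcdA N : ℤ), ?_, ?_⟩
  · rw [map_zpow, hbez, zpow_sub, zpow_mul, zpow_natCast, ha]
    simp
  · rw [← zpow_natCast, ← zpow_mul, mul_comm, ← mul_assoc, zpow_mul, zpow_mul, zpow_natCast,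
      zpow_natCast, hb, one_zpow]

theorem exists_lift_pow_two_pow_eq_one {W k : Type} [CommRing W] [Field k] [CharP k 2]
    {r : W →+* k} {d : ℕ} (n : ℕ)
    (hr : Function.Surjective (Matrix.GeneralLinearGroup.map (n := Fin d) r))
    {A : GL (Fin d) k} (hA : A ^ 2 ^ n = 1) :
    ∃ B : GL (Fin d) W, Matrix.GeneralLinearGroup.map r B = A ∧ B ^ 2 ^ n = 1 := by
  have hφ : (Matrix.toLin' (A : Matrix (Fin d) (Fin d) k)) ^ 2 ^ n = 1 := by
    rw [← Matrix.toLin'_pow, ← Units.val_pow_eq_pow_val, hA, Units.val_one, Matrix.toLin'_one]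
    rfl
  obtain ⟨ι, _, _, b, B, hB, hb⟩ := Module.End.IsLiftable.of_pow_two_pow_eq_one (r := r) n hφ
  let σ : ι ≃ Fin d := Fintype.equivFinOfCardEq (by
    rw [← Module.finrank_eq_card_basis b, Module.finrank_fin_fun])
  let c := b.reindex σ
  let := (Pi.basisFun k (Fin d)).invertibleToMatrix c
  let P : GL (Fin d) k := unitOfInvertible ((Pi.basisFun k (Fin d)).toMatrix c)
  obtain ⟨Q, hQ⟩ := hr P
  have hC : Matrix.reindexAlgEquiv W W σ B ^ 2 ^ n = 1 := by rw [← map_pow, hB, map_one]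
  let C : GL (Fin d) W := Units.ofPowEqOne _ _ hC (by positivity)
  have hAP : A * P = P * Matrix.GeneralLinearGroup.map r C := by
    ext i j
    have h := congr_fun (hb (σ.symm j)) i
    rw [Matrix.toLin'_apply, Finset.sum_apply, ← σ.symm.sum_comp] at h
    simp only [Units.val_mul, Matrix.mul_apply]
    simpa [Matrix.mulVec, dotProduct, P, C, c, Basis.toMatrix_apply, mul_comm] using h
  refine ⟨Q * C * Q⁻¹, ?_, ?_⟩
  · rw [map_mul, map_mul, map_inv, hQ, ← hAP, mul_inv_cancel_right]
  · rw [conj_pow, Units.pow_ofPowEqOne, mul_one, mul_inv_cancel]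

end Main

/-- the cyclic group `ℤ/2^nℤ` has property `L` for every `n ≥ 0`. -/
theorem zmod_two_pow_hasL (n : ℕ) : HasL (Multiplicative (ZMod (2 ^ n))) := by
  intro p _ d _ k _ _ _ f
  have hr := Matrix.GeneralLinearGroup.map_surjective_of_ker_mul_eq_zero (m := Fin d)
    (wittReduce p k) (wittReduce_surjective p k) (mul_eq_zero_of_wittReduce_eq_zero p k)
  have hf : f (.ofAdd 1) ^ 2 ^ n = 1 := by
    rw [← map_pow, ← ofAdd_nsmul]
    simp
  obtain ⟨B, hBA, hB⟩ : ∃ B : GL (Fin d) (TruncatedWittVector p 2 k),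
      Matrix.GeneralLinearGroup.map (wittReduce p k) B = f (.ofAdd 1) ∧ B ^ 2 ^ n = 1 := by
    rcases eq_or_ne p 2 with rfl | hp
    · exact exists_lift_pow_two_pow_eq_one n hr hf
    · refine exists_lift_pow_eq_one_of_coprime hr (p := p) (fun x hx => Units.ext ?_) ?_ hf
      · exact Matrix.pow_eq_one_of_mapMatrix_eq_one (wittReduce p k)
          (mul_eq_zero_of_wittReduce_eq_zero p k) (congr_arg Units.val hx)
      · exact Nat.Coprime.pow_right _ ((Nat.coprime_primes Fact.out Nat.prime_two).mpr hp)
  obtain ⟨g, hg⟩ := exists_zmod_hom hB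
  exact ⟨g, zmod_hom_ext (by simp [hg, hBA])⟩
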